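/- Typing soundness of the quantitative inference algorithm: if T_Q(M) = ([x₁:τ⃗₁, …, xₙ:τ⃗ₙ], σ, b), then there exist an index b' ∈ ℕ, rank 1 multi-types t⃗₁, …, t⃗ₙ and a rank 2 multi-type s such that [x₁:(τ⃗₁,t⃗₁), …, xₙ:(τ⃗ₙ,t⃗ₙ)] ⊢^{b'} M : σ | s is derivable in the Linear Rank 2 Quantitative Type System. -/

import Mathlib

/-! ## λ-terms -/

inductive Term : Type
  | var : ℕ → Term
  | lam : ℕ → Term → Term
  | app : Term → Term → Term

namespace Term

/-- free variables -/
def fv : Term → Finset ℕ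
  | .var x => {x}
  | .lam x M => fv M \ {x}
  | .app M N => fv M ∪ fv N

/-- all variables occurring in a term (free, bound or binding) -/
def allVars : Term → Finset ℕ
  | .var x => {x}
  | .lam x M => insert x (allVars M)
  | .app M N => allVars M ∪ allVars N

/-- substitution `M[N/x]` (as in the paper, under the variable convention) -/
def subst : Term → ℕ → Term → Term
  | .var y, x, N => if y = x then N else .var y
  | .lam y M, x, N => if y = x then .lam y M else .lam y (subst M x N)
  | .app M₁ M₂, x, N => .app (subst M₁ x N) (subst M₂ x N)

/-- simultaneous renaming `M[y₁/x₁, …, yₙ/xₙ]` (the `yᵢ` being fresh) -/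
def renList (M : Term) (xs ys : List ℕ) : Term :=
  (xs.zip ys).foldl (fun N q => N.subst q.1 (.var q.2)) M

/-- `M` is an abstraction -/
def IsAbs (M : Term) : Prop := ∃ x N, M = lam x N

end Term

/-! ## Linear types and linear rank 2 intersection types -/

/-- linear types (linear rank 0 intersection types) -/
inductive LTy : Type
  | var : ℕ → LTy
  | lolly : LTy → LTy → LTy

/-- type variables of a linear type -/
def LTy.tv : LTy → Finset ℕ
  | .var α => {α}
  | .lolly a b => a.tv ∪ b.tv

/-- linear rank 2 intersection types: `σ ::= τ | τ ⊸ σ | (τ₁ ∩ ⋯ ∩ τₙ) → σ`.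
Sequences (linear rank 1 types) are multisets of linear types (`∩` is associative,
commutative and non-idempotent); the constraint `n ≥ 2` on `arrow` is enforced in
the typing rules. -/
inductive Ty2 : Type
  | lin : LTy → Ty2
  | lolly : LTy → Ty2 → Ty2
  | arrow : Multiset LTy → Ty2 → Ty2

/-- `τ ⊸ σ`: identifies `τ ⊸ τ'` (for `τ'` linear) with the linear type `τ ⊸ τ'`,
so that every rank 2 type has a unique representation. -/
def Ty2.mkLolly (τ : LTy) : Ty2 → Ty2
  | .lin τ' => .lin (.lolly τ τ')
  | σ => .lolly τ σ

/-- type variables of a rank 2 type -/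
def Ty2.tv : Ty2 → Finset ℕ
  | .lin τ => τ.tv
  | .lolly τ σ => τ.tv ∪ σ.tv
  | .arrow A σ => (A.map LTy.tv).sup ∪ σ.tv

/-- type substitutions (mapping type variables to linear types) -/
abbrev TSub := ℕ → LTy

def LTy.applyS (S : TSub) : LTy → LTy
  | .var α => S α
  | .lolly a b => .lolly (a.applyS S) (b.applyS S)

def Ty2.applyS (S : TSub) : Ty2 → Ty2
  | .lin τ => .lin (τ.applyS S)
  | .lolly τ σ => .lolly (τ.applyS S) (σ.applyS S)
  | .arrow A σ => .arrow (A.map (LTy.applyS S)) (σ.applyS S)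

/-! ## Environments -/

section GEnv
variable {β : Type}

/-- the domain of an environment -/
def domG (Γ : List (ℕ × β)) : List ℕ := Γ.map Prod.fst

/-- a finite list of declarations is consistent iff the term variables are distinct -/
def consistentG (Γ : List (ℕ × β)) : Prop := (Γ.map Prod.fst).Nodup

/-- the predicate declared for `x` (defaulting to `0`, i.e. empty) -/
def lookupG [Zero β] (Γ : List (ℕ × β)) (x : ℕ) : β :=
  ((Γ.find? (fun p => p.1 == x)).map Prod.snd).getD 0

/-- `Γ₁ + Γ₂`: merge two environments, intersecting the predicates of common
variables; declarations of `Γ₁` come first, in order, followed by the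
declarations of variables only in `Γ₂`, in order. -/
def addG [Zero β] [Add β] (Γ₁ Γ₂ : List (ℕ × β)) : List (ℕ × β) :=
  Γ₁.map (fun p => (p.1, p.2 + lookupG Γ₂ p.1)) ++
    Γ₂.filter (fun p => !((Γ₁.map Prod.fst).contains p.1))

/-- `Σᵢ Γᵢ` -/
def sumG [Zero β] [Add β] (l : List (List (ℕ × β))) : List (ℕ × β) :=
  l.foldr addG []

/-- `Γ_x` : remove the declaration of `x` from `Γ` -/
def eraseG (Γ : List (ℕ × β)) (x : ℕ) : List (ℕ × β) :=
  Γ.filter (fun p => !(p.1 == x))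

/-- `Γ[y/x]` : rename the declared variable `x` to `y` -/
def renG (Γ : List (ℕ × β)) (x y : ℕ) : List (ℕ × β) :=
  Γ.map (fun p => (if p.1 = x then y else p.1, p.2))

/-- `Γ[y₁/x₁, …, yₙ/xₙ]` -/
def renListG (Γ : List (ℕ × β)) (xs ys : List ℕ) : List (ℕ × β) :=
  (xs.zip ys).foldl (fun Δ q => renG Δ q.1 q.2) Γ

end GEnv

/-- environments of the Linear Rank 2 Intersection Type System
(also called `T¹_L`-environments) -/
abbrev Env := List (ℕ × Multiset LTy)

/-- applying a type substitution to an environment -/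
def envApplyS (S : TSub) (Γ : Env) : Env :=
  Γ.map (fun p => (p.1, p.2.map (LTy.applyS S)))

/-- the type variables occurring in an environment -/
def envTv (Γ : Env) : Finset ℕ :=
  Γ.foldr (fun p acc => (p.2.map LTy.tv).sup ∪ acc) ∅

/-- the type variables occurring in a pair (environment, type) -/
def tvOf (Γ : Env) (σ : Ty2) : Finset ℕ := envTv Γ ∪ σ.tv

/-! ## The Linear Rank 2 Intersection Type System (with depth-indexed derivations) -/

/-- `DerN d Γ M σ`: there is a derivation of depth `d` of `Γ ⊢₂ M : σ`. -/
inductive DerN : ℕ → Env → Term → Ty2 → Prop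
  | ax (x : ℕ) (τ : LTy) :
      DerN 0 [(x, {τ})] (.var x) (.lin τ)
  | exch (d : ℕ) (Γ₁ Γ₂ : Env) (x y : ℕ) (A B : Multiset LTy) (M : Term) (σ : Ty2) :
      DerN d (Γ₁ ++ (x, A) :: (y, B) :: Γ₂) M σ →
      DerN (d + 1) (Γ₁ ++ (y, B) :: (x, A) :: Γ₂) M σ
  | contr (d : ℕ) (Γ₁ Γ₂ : Env) (x₁ x₂ x : ℕ) (A B : Multiset LTy) (M : Term) (σ : Ty2) :
      DerN d (Γ₁ ++ (x₁, A) :: (x₂, B) :: Γ₂) M σ →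
      x ∉ domG (Γ₁ ++ Γ₂) →
      DerN (d + 1) (Γ₁ ++ (x, A + B) :: Γ₂) ((M.subst x₁ (.var x)).subst x₂ (.var x)) σ
  | introArrow (d : ℕ) (Γ : Env) (x : ℕ) (A : Multiset LTy) (M : Term) (σ : Ty2) :
      DerN d (Γ ++ [(x, A)]) M σ →
      2 ≤ Multiset.card A →
      DerN (d + 1) Γ (.lam x M) (.arrow A σ)
  | introLolly (d : ℕ) (Γ : Env) (x : ℕ) (τ : LTy) (M : Term) (σ : Ty2) :
      DerN d (Γ ++ [(x, ({τ} : Multiset LTy))]) M σ →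
      DerN (d + 1) Γ (.lam x M) (Ty2.mkLolly τ σ)
  | elimLolly (d₁ d₂ : ℕ) (Γ₁ Γ₂ : Env) (M₁ M₂ : Term) (τ : LTy) (σ : Ty2) :
      DerN d₁ Γ₁ M₁ (Ty2.mkLolly τ σ) →
      DerN d₂ Γ₂ M₂ (.lin τ) →
      consistentG (Γ₁ ++ Γ₂) →
      DerN (max d₁ d₂ + 1) (Γ₁ ++ Γ₂) (.app M₁ M₂) σ
  | elimArrow (d : ℕ) (Γ : Env) (M₁ M₂ : Term) (σ : Ty2) (l : List (ℕ × Env × LTy)) :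
      DerN d Γ M₁ (.arrow (Multiset.ofList (l.map (fun p => p.2.2))) σ) →
      (∀ p ∈ l, DerN p.1 p.2.1 M₂ (.lin p.2.2)) →
      2 ≤ l.length →
      consistentG (Γ ++ sumG (l.map (fun p => p.2.1))) →
      DerN (max d ((l.map Prod.fst).foldr max 0) + 1)
        (Γ ++ sumG (l.map (fun p => p.2.1))) (.app M₁ M₂) σ

/-- `Γ ⊢₂ M : σ` in the Linear Rank 2 Intersection Type System. -/
def Der (Γ : Env) (M : Term) (σ : Ty2) : Prop := ∃ d, DerN d Γ M σ

/-! ## Unification and the type inference algorithm -/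

/-- `S` unifies all the equations of `P` -/
def Unifies (S : TSub) (P : List (LTy × LTy)) : Prop :=
  ∀ e ∈ P, LTy.applyS S e.1 = LTy.applyS S e.2

/-- `S` is a most general unifier of `P` -/
def IsMGU (S : TSub) (P : List (LTy × LTy)) : Prop :=
  Unifies S P ∧ ∀ S' : TSub, Unifies S' P →
    ∃ S'' : TSub, ∀ α, S' α = LTy.applyS S'' (S α)

/-- `Infer M Γ σ` : the type inference algorithm, run on `M`, may return `(Γ, σ)`
(fresh type variables are modelled by disjointness side conditions). -/
inductive Infer : Term → Env → Ty2 → Prop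
  | var (x α : ℕ) :
      Infer (.var x) [(x, {LTy.var α})] (.lin (.var α))
  | lamLolly {M₁ : Term} {Γ₁ : Env} {σ₁ : Ty2} (x : ℕ) (τ : LTy) :
      Infer M₁ Γ₁ σ₁ →
      (x, ({τ} : Multiset LTy)) ∈ Γ₁ →
      Infer (.lam x M₁) (eraseG Γ₁ x) (Ty2.mkLolly τ σ₁)
  | lamArrow {M₁ : Term} {Γ₁ : Env} {σ₁ : Ty2} (x : ℕ) (A : Multiset LTy) :
      Infer M₁ Γ₁ σ₁ →
      (x, A) ∈ Γ₁ →
      2 ≤ Multiset.card A →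
      Infer (.lam x M₁) (eraseG Γ₁ x) (.arrow A σ₁)
  | appVar {M₁ M₂ : Term} {Γ₁ Γ₂ : Env} (α₁ : ℕ) (τ₂ : LTy) (α₂ α₃ : ℕ) (S : TSub) :
      Infer M₁ Γ₁ (.lin (.var α₁)) →
      Infer M₂ Γ₂ (.lin τ₂) →
      Disjoint (tvOf Γ₁ (.lin (.var α₁))) (tvOf Γ₂ (.lin τ₂)) →
      α₂ ∉ tvOf Γ₁ (.lin (.var α₁)) ∪ tvOf Γ₂ (.lin τ₂) →
      α₃ ∉ tvOf Γ₁ (.lin (.var α₁)) ∪ tvOf Γ₂ (.lin τ₂) →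
      α₂ ≠ α₃ →
      IsMGU S [(LTy.var α₁, LTy.lolly (.var α₂) (.var α₃)), (τ₂, LTy.var α₂)] →
      Infer (.app M₁ M₂) (envApplyS S (addG Γ₁ Γ₂)) (.lin (S α₃))
  | appArrow {M₁ M₂ : Term} {Γ₁ : Env} {σ₁ : Ty2}
      (l : List (Env × LTy)) (ts : List LTy) (S : TSub) :
      Infer M₁ Γ₁ (.arrow (Multiset.ofList ts) σ₁) →
      (∀ p ∈ l, Infer M₂ p.1 (.lin p.2)) →
      l.length = ts.length →
      2 ≤ l.length →
      List.Pairwise (fun p q => Disjoint (tvOf p.1 (.lin p.2)) (tvOf q.1 (.lin q.2))) l →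
      (∀ p ∈ l, Disjoint (tvOf Γ₁ (.arrow (Multiset.ofList ts) σ₁)) (tvOf p.1 (.lin p.2))) →
      IsMGU S ((l.map Prod.snd).zip ts) →
      Infer (.app M₁ M₂) (envApplyS S (addG Γ₁ (sumG (l.map Prod.fst)))) (Ty2.applyS S σ₁)
  | appLolly {M₁ M₂ : Term} {Γ₁ Γ₂ : Env} (τ : LTy) (σ₁ : Ty2) (τ₂ : LTy) (S : TSub) :
      Infer M₁ Γ₁ (Ty2.mkLolly τ σ₁) →
      Infer M₂ Γ₂ (.lin τ₂) →
      Disjoint (tvOf Γ₁ (Ty2.mkLolly τ σ₁)) (tvOf Γ₂ (.lin τ₂)) →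
      IsMGU S [(τ₂, τ)] →
      Infer (.app M₁ M₂) (envApplyS S (addG Γ₁ Γ₂)) (Ty2.applyS S σ₁)

/-! ## Multi-types and the Linear Rank 2 Quantitative Type System -/

/-- rank 0 multi-types: `t ::= Neutral | Abs | α | t ⊸ t` -/
inductive MTy : Type
  | Neutral : MTy
  | Abs : MTy
  | var : ℕ → MTy
  | lolly : MTy → MTy → MTy

/-- rank 2 multi-types (rank 1 multi-types are multisets of rank 0 multi-types) -/
inductive MTy2 : Type
  | base : MTy → MTy2
  | lolly : MTy → MTy2 → MTy2
  | arrow : Multiset MTy → MTy2 → MTy2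

/-- `t ⊸ s`, identifying `t ⊸ t'` with the rank 0 multi-type `t ⊸ t'` -/
def MTy2.mkLolly (t : MTy) : MTy2 → MTy2
  | .base t' => .base (.lolly t t')
  | s => .lolly t s

/-- a rank 0 multi-type is tight iff it is one of the tight constants -/
def MTy.tight (t : MTy) : Prop := t = .Neutral ∨ t = .Abs

/-- a rank 1 multi-type is tight iff all its components are -/
def tightSeq (ts : Multiset MTy) : Prop := ∀ t ∈ ts, MTy.tight t

/-- a rank 2 multi-type is tight iff it is a tight constant -/
def MTy2.tight (s : MTy2) : Prop := s = .base .Neutral ∨ s = .base .Abs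

/-- environments of the quantitative system: each declaration carries a pair
(sequence of linear types, rank 1 multi-type) -/
abbrev QEnv := List (ℕ × (Multiset LTy × Multiset MTy))

/-- a quantitative environment is tight iff all its multi-type components are -/
def tightE (Γ : QEnv) : Prop := ∀ p ∈ Γ, tightSeq p.2.2

/-- the Linear Rank 2 Quantitative Type System: `QDer Γ b M σ s` is
`Γ ⊢^b M : σ | s`. -/
inductive QDer : QEnv → ℕ → Term → Ty2 → MTy2 → Prop
  | ax (x : ℕ) (τ : LTy) (t : MTy) :
      QDer [(x, ({τ}, {t}))] 0 (.var x) (.lin τ) (.base t)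
  | exch (Γ₁ Γ₂ : QEnv) (x y : ℕ) (A B : Multiset LTy × Multiset MTy)
      (b : ℕ) (M : Term) (σ : Ty2) (s : MTy2) :
      QDer (Γ₁ ++ (x, A) :: (y, B) :: Γ₂) b M σ s →
      QDer (Γ₁ ++ (y, B) :: (x, A) :: Γ₂) b M σ s
  | contr (Γ₁ Γ₂ : QEnv) (x₁ x₂ x : ℕ) (A₁ A₂ : Multiset LTy × Multiset MTy)
      (b : ℕ) (M : Term) (σ : Ty2) (s : MTy2) :
      QDer (Γ₁ ++ (x₁, A₁) :: (x₂, A₂) :: Γ₂) b M σ s →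
      x ∉ domG (Γ₁ ++ Γ₂) →
      QDer (Γ₁ ++ (x, A₁ + A₂) :: Γ₂) b ((M.subst x₁ (.var x)).subst x₂ (.var x)) σ s
  | introLolly (Γ : QEnv) (x : ℕ) (τ : LTy) (t : MTy) (b : ℕ) (M : Term) (σ : Ty2) (s : MTy2) :
      QDer (Γ ++ [(x, ({τ}, {t}))]) b M σ s →
      QDer Γ (b + 1) (.lam x M) (Ty2.mkLolly τ σ) (MTy2.mkLolly t s)
  | introLollyT (Γ : QEnv) (x : ℕ) (τ : LTy) (t : MTy) (b : ℕ) (M : Term) (σ : Ty2) (s : MTy2) :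
      QDer (Γ ++ [(x, ({τ}, {t}))]) b M σ s →
      MTy.tight t →
      MTy2.tight s →
      QDer Γ b (.lam x M) (Ty2.mkLolly τ σ) (.base .Abs)
  | introArrow (Γ : QEnv) (x : ℕ) (A : Multiset LTy) (ts : Multiset MTy)
      (b : ℕ) (M : Term) (σ : Ty2) (s : MTy2) :
      QDer (Γ ++ [(x, (A, ts))]) b M σ s →
      2 ≤ Multiset.card A →
      Multiset.card ts = Multiset.card A →
      QDer Γ (b + 1) (.lam x M) (.arrow A σ) (.arrow ts s)
  | introArrowT (Γ : QEnv) (x : ℕ) (A : Multiset LTy) (ts : Multiset MTy)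
      (b : ℕ) (M : Term) (σ : Ty2) (s : MTy2) :
      QDer (Γ ++ [(x, (A, ts))]) b M σ s →
      2 ≤ Multiset.card A →
      tightSeq ts →
      MTy2.tight s →
      QDer Γ b (.lam x M) (.arrow A σ) (.base .Abs)
  | elimLolly (Γ₁ Γ₂ : QEnv) (b₁ b₂ : ℕ) (M₁ M₂ : Term) (τ : LTy) (σ : Ty2) (t : MTy) (s : MTy2) :
      QDer Γ₁ b₁ M₁ (Ty2.mkLolly τ σ) (MTy2.mkLolly t s) →
      QDer Γ₂ b₂ M₂ (.lin τ) (.base t) →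
      consistentG (Γ₁ ++ Γ₂) →
      QDer (Γ₁ ++ Γ₂) (b₁ + b₂) (.app M₁ M₂) σ s
  | elimLollyT (Γ₁ Γ₂ : QEnv) (b₁ b₂ : ℕ) (M₁ M₂ : Term) (τ : LTy) (σ : Ty2) (s₂ : MTy2) :
      QDer Γ₁ b₁ M₁ (Ty2.mkLolly τ σ) (.base .Neutral) →
      QDer Γ₂ b₂ M₂ (.lin τ) s₂ →
      MTy2.tight s₂ →
      consistentG (Γ₁ ++ Γ₂) →
      QDer (Γ₁ ++ Γ₂) (b₁ + b₂) (.app M₁ M₂) σ (.base .Neutral)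
  | elimArrow (Γ : QEnv) (b : ℕ) (M₁ M₂ : Term) (σ : Ty2) (s : MTy2)
      (l : List (QEnv × ℕ × LTy × MTy)) :
      QDer Γ b M₁ (.arrow (Multiset.ofList (l.map (fun p => p.2.2.1))) σ)
        (.arrow (Multiset.ofList (l.map (fun p => p.2.2.2))) s) →
      (∀ p ∈ l, QDer p.1 p.2.1 M₂ (.lin p.2.2.1) (.base p.2.2.2)) →
      2 ≤ l.length →
      consistentG (Γ ++ sumG (l.map Prod.fst)) →
      QDer (Γ ++ sumG (l.map Prod.fst)) (b + (l.map (fun p => p.2.1)).sum) (.app M₁ M₂) σ s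
  | elimArrowT (Γ : QEnv) (b : ℕ) (M₁ M₂ : Term) (σ : Ty2)
      (l : List (QEnv × ℕ × LTy × MTy2)) :
      QDer Γ b M₁ (.arrow (Multiset.ofList (l.map (fun p => p.2.2.1))) σ) (.base .Neutral) →
      (∀ p ∈ l, QDer p.1 p.2.1 M₂ (.lin p.2.2.1) p.2.2.2) →
      (∀ p ∈ l, MTy2.tight p.2.2.2) →
      2 ≤ l.length →
      consistentG (Γ ++ sumG (l.map Prod.fst)) →
      QDer (Γ ++ sumG (l.map Prod.fst)) (b + (l.map (fun p => p.2.1)).sum)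
        (.app M₁ M₂) σ (.base .Neutral)

/-! ## Leftmost-outermost normal forms and evaluation -/

namespace Term

mutual
  /-- leftmost-outermost neutral terms -/
  inductive Neutral : Term → Prop
    | var (x : ℕ) : Neutral (.var x)
    | app {M N : Term} : Neutral M → Normal N → Neutral (.app M N)
  /-- leftmost-outermost normal terms -/
  inductive Normal : Term → Prop
    | of_neutral {M : Term} : Neutral M → Normal M
    | lam (x : ℕ) {M : Term} : Normal M → Normal (.lam x M)
end

/-- one step of the leftmost-outermost evaluation strategy -/
inductive Step : Term → Term → Prop
  | beta (x : ℕ) (M N : Term) : Step (.app (.lam x M) N) (M.subst x N)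
  | lam (x : ℕ) {M M' : Term} : Step M M' → Step (.lam x M) (.lam x M')
  | appL {M M' N : Term} : Step M M' → ¬ IsAbs M → Step (.app M N) (.app M' N)
  | appR {N M M' : Term} : Neutral N → Step M M' → Step (.app N M) (.app N M')

/-- `StepsN b M N` : `M ⟶^b N`, i.e. `M` reduces to `N` in exactly `b`
leftmost-outermost steps -/
inductive StepsN : ℕ → Term → Term → Prop
  | refl (M : Term) : StepsN 0 M M
  | step {M M' N : Term} {b : ℕ} : Step M M' → StepsN b M' N → StepsN (b + 1) M N

end Term

/-! ## Quantitative unification and the quantitative type inference algorithm -/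

/-- `[τ/α]` applied to a linear type -/
def substVar (τ : LTy) (α : ℕ) : LTy → LTy
  | .var β => if β = α then τ else .var β
  | .lolly a b => .lolly (substVar τ α a) (substVar τ α b)

/-- `[τ/α]` applied to a unification problem -/
def substEqs (τ : LTy) (α : ℕ) (P : Multiset (LTy × LTy)) : Multiset (LTy × LTy) :=
  P.map (fun e => (substVar τ α e.1, substVar τ α e.2))

/-- `α` occurs in the unification problem `P` -/
def occursIn (α : ℕ) (P : Multiset (LTy × LTy)) : Prop :=
  ∃ e ∈ P, α ∈ e.1.tv ∨ α ∈ e.2.tv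

/-- one transformation step `P ⇒ P'` on unification problems; the third component
is `1` for a decomposition step `{τ₁ ⊸ τ₂ = τ₃ ⊸ τ₄} ∪ P ⇒ {τ₁ = τ₃, τ₂ = τ₄} ∪ P`
and `0` otherwise -/
inductive UStep : Multiset (LTy × LTy) → Multiset (LTy × LTy) → ℕ → Prop
  | del (τ : LTy) (P : Multiset (LTy × LTy)) :
      UStep ((τ, τ) ::ₘ P) P 0
  | dec (a b c d : LTy) (P : Multiset (LTy × LTy)) :
      UStep ((LTy.lolly a b, LTy.lolly c d) ::ₘ P) ((a, c) ::ₘ (b, d) ::ₘ P) 1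
  | swap (a b : LTy) (α : ℕ) (P : Multiset (LTy × LTy)) :
      UStep ((LTy.lolly a b, LTy.var α) ::ₘ P) ((LTy.var α, LTy.lolly a b) ::ₘ P) 0
  | elim (α : ℕ) (τ : LTy) (P : Multiset (LTy × LTy)) :
      occursIn α P →
      α ∉ τ.tv →
      UStep ((LTy.var α, τ) ::ₘ P) ((LTy.var α, τ) ::ₘ substEqs τ α P) 0

/-- iterated transformation steps, accumulating the number of decompositions -/
inductive URun : Multiset (LTy × LTy) → Multiset (LTy × LTy) → ℕ → Prop
  | refl (P : Multiset (LTy × LTy)) : URun P P 0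
  | step {P Q R : Multiset (LTy × LTy)} {k b : ℕ} :
      UStep P Q k → URun Q R b → URun P R (k + b)

/-- `P` is in solved form, inducing the substitution `S` -/
def SolvedWith (P : Multiset (LTy × LTy)) (S : TSub) : Prop :=
  ∃ L : List (ℕ × LTy),
    Multiset.ofList (L.map (fun p => (LTy.var p.1, p.2))) = P ∧
    (L.map Prod.fst).Nodup ∧
    (∀ p ∈ L, ∀ q ∈ L, p.1 ∉ q.2.tv) ∧
    S = fun β => (((L.find? (fun p => p.1 == β)).map Prod.snd).getD (LTy.var β))

/-- `UNIFY_Q(P) = (S, b)`: the quantitative unification algorithm succeeds on `P`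
returning the most general unifier `S` and the number `b` of decomposition steps -/
def UnifyQ (P : Multiset (LTy × LTy)) (S : TSub) (b : ℕ) : Prop :=
  ∃ P', URun P P' b ∧ (∀ Q k, ¬ UStep P' Q k) ∧ SolvedWith P' S

/-- `QInfer M Γ σ b` : the quantitative type inference algorithm `T_Q`, run on
`M`, may return `(Γ, σ, b)`. -/
inductive QInfer : Term → Env → Ty2 → ℕ → Prop
  | var (x α : ℕ) :
      QInfer (.var x) [(x, {LTy.var α})] (.lin (.var α)) 0
  | lamLolly {M₁ : Term} {Γ₁ : Env} {σ₁ : Ty2} {b₁ : ℕ} (x : ℕ) (τ : LTy) :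
      QInfer M₁ Γ₁ σ₁ b₁ →
      (x, ({τ} : Multiset LTy)) ∈ Γ₁ →
      QInfer (.lam x M₁) (eraseG Γ₁ x) (Ty2.mkLolly τ σ₁) b₁
  | lamArrow {M₁ : Term} {Γ₁ : Env} {σ₁ : Ty2} {b₁ : ℕ} (x : ℕ) (A : Multiset LTy) :
      QInfer M₁ Γ₁ σ₁ b₁ →
      (x, A) ∈ Γ₁ →
      2 ≤ Multiset.card A →
      QInfer (.lam x M₁) (eraseG Γ₁ x) (.arrow A σ₁) b₁
  | appVar {M₁ M₂ : Term} {Γ₁ Γ₂ : Env} {b₁ b₂ : ℕ}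
      (α₁ : ℕ) (τ₂ : LTy) (α₂ α₃ : ℕ) (S : TSub) (bu : ℕ) :
      QInfer M₁ Γ₁ (.lin (.var α₁)) b₁ →
      QInfer M₂ Γ₂ (.lin τ₂) b₂ →
      Disjoint (tvOf Γ₁ (.lin (.var α₁))) (tvOf Γ₂ (.lin τ₂)) →
      α₂ ∉ tvOf Γ₁ (.lin (.var α₁)) ∪ tvOf Γ₂ (.lin τ₂) →
      α₃ ∉ tvOf Γ₁ (.lin (.var α₁)) ∪ tvOf Γ₂ (.lin τ₂) →
      α₂ ≠ α₃ →
      UnifyQ {(LTy.var α₁, LTy.lolly (.var α₂) (.var α₃)), (τ₂, LTy.var α₂)} S bu →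
      QInfer (.app M₁ M₂) (envApplyS S (addG Γ₁ Γ₂)) (.lin (S α₃)) (b₁ + b₂)
  | appArrow {M₁ M₂ : Term} {Γ₁ : Env} {σ₁ : Ty2} {b₁ : ℕ}
      (l : List (Env × LTy × ℕ)) (ts : List LTy) (S : TSub) (bu : ℕ) :
      QInfer M₁ Γ₁ (.arrow (Multiset.ofList ts) σ₁) b₁ →
      (∀ p ∈ l, QInfer M₂ p.1 (.lin p.2.1) p.2.2) →
      l.length = ts.length →
      2 ≤ l.length →
      List.Pairwise (fun p q => Disjoint (tvOf p.1 (.lin p.2.1)) (tvOf q.1 (.lin q.2.1))) l →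
      (∀ p ∈ l, Disjoint (tvOf Γ₁ (.arrow (Multiset.ofList ts) σ₁)) (tvOf p.1 (.lin p.2.1))) →
      UnifyQ (Multiset.ofList ((l.map (fun p => p.2.1)).zip ts)) S bu →
      QInfer (.app M₁ M₂) (envApplyS S (addG Γ₁ (sumG (l.map Prod.fst)))) (Ty2.applyS S σ₁)
        (b₁ + (l.map (fun p => p.2.2)).sum + bu + 1)
  | appLolly {M₁ M₂ : Term} {Γ₁ Γ₂ : Env} {b₁ b₂ : ℕ}
      (τ : LTy) (σ₁ : Ty2) (τ₂ : LTy) (S : TSub) (bu : ℕ) :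
      QInfer M₁ Γ₁ (Ty2.mkLolly τ σ₁) b₁ →
      QInfer M₂ Γ₂ (.lin τ₂) b₂ →
      Disjoint (tvOf Γ₁ (Ty2.mkLolly τ σ₁)) (tvOf Γ₂ (.lin τ₂)) →
      UnifyQ {(τ₂, τ)} S bu →
      QInfer (.app M₁ M₂) (envApplyS S (addG Γ₁ Γ₂)) (Ty2.applyS S σ₁) (b₁ + b₂ + bu + 1)

/-! ## Soundness of unification -/

theorem applyS_substVar (S : TSub) (τ : LTy) (α : ℕ) (h : S α = τ.applyS S) (ρ : LTy) :
    (substVar τ α ρ).applyS S = ρ.applyS S := by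
  induction ρ with
  | var β =>
    by_cases hβ : β = α
    · subst hβ; simp [substVar, LTy.applyS, h]
    · simp [substVar, hβ]
  | lolly a b iha ihb => simp [substVar, LTy.applyS, iha, ihb]

theorem UStep.unifies_of {P Q : Multiset (LTy × LTy)} {k : ℕ} (h : UStep P Q k) (S : TSub)
    (hQ : ∀ e ∈ Q, e.1.applyS S = e.2.applyS S) :
    ∀ e ∈ P, e.1.applyS S = e.2.applyS S := by
  cases h with
  | del τ P => simpa using hQ
  | dec a b c d P =>
    simp only [Multiset.mem_cons, forall_eq_or_imp] at hQ ⊢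
    exact ⟨by simp [LTy.applyS, hQ.1, hQ.2.1], hQ.2.2⟩
  | swap a b α P =>
    simp only [Multiset.mem_cons, forall_eq_or_imp] at hQ ⊢
    exact ⟨hQ.1.symm, hQ.2⟩
  | elim α τ P _ _ =>
    simp only [Multiset.mem_cons, forall_eq_or_imp] at hQ ⊢
    refine ⟨hQ.1, fun e he => ?_⟩
    have := hQ.2 (substVar τ α e.1, substVar τ α e.2)
      (Multiset.mem_map_of_mem (fun e : LTy × LTy => (substVar τ α e.1, substVar τ α e.2)) he)
    simpa [applyS_substVar S τ α hQ.1] using this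

theorem URun.unifies_of {P Q : Multiset (LTy × LTy)} {k : ℕ} (h : URun P Q k) (S : TSub)
    (hQ : ∀ e ∈ Q, e.1.applyS S = e.2.applyS S) :
    ∀ e ∈ P, e.1.applyS S = e.2.applyS S := by
  induction h with
  | refl P => exact hQ
  | step h _ ih => exact h.unifies_of S (ih hQ)

theorem LTy.applyS_eq_self (S : TSub) (τ : LTy) (h : ∀ α ∈ τ.tv, S α = .var α) :
    τ.applyS S = τ := by
  induction τ with
  | var α => exact h α (by simp [LTy.tv])
  | lolly a b iha ihb =>
    simp only [LTy.tv, Finset.mem_union] at h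
    simp [LTy.applyS, iha fun α hα => h α (.inl hα), ihb fun α hα => h α (.inr hα)]

theorem find?_fst_of_mem {β : Type} {L : List (ℕ × β)} (hL : (L.map Prod.fst).Nodup)
    {p : ℕ × β} (hp : p ∈ L) : L.find? (fun q => q.1 == p.1) = some p := by
  induction L with
  | nil => simp at hp
  | cons q L ih =>
    simp only [List.map_cons, List.nodup_cons] at hL
    rcases List.mem_cons.1 hp with rfl | hp'
    · simp
    · have : q.1 ≠ p.1 := fun h => hL.1 (h ▸ List.mem_map_of_mem hp')
      simp [this, ih hL.2 hp']

theorem find?_fst_of_notMem {β : Type} {L : List (ℕ × β)} {x : ℕ}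
    (hx : x ∉ L.map Prod.fst) : L.find? (fun q => q.1 == x) = none := by
  simp only [List.find?_eq_none, beq_iff_eq]
  exact fun p hp h => hx (h ▸ List.mem_map_of_mem hp)

theorem SolvedWith.unifies {P : Multiset (LTy × LTy)} {S : TSub} (h : SolvedWith P S) :
    ∀ e ∈ P, e.1.applyS S = e.2.applyS S := by
  obtain ⟨L, rfl, hnd, hocc, rfl⟩ := h
  intro e he
  simp only [Multiset.mem_coe, List.mem_map] at he
  obtain ⟨p, hp, rfl⟩ := he
  rw [LTy.applyS_eq_self _ p.2]
  · simp [LTy.applyS, find?_fst_of_mem hnd hp]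
  · intro α hα
    have : α ∉ L.map Prod.fst := by
      intro hmem
      obtain ⟨q, hq, rfl⟩ := List.mem_map.1 hmem
      exact hocc q hq p hp hα
    simp [find?_fst_of_notMem this]

theorem UnifyQ.unifies {P : Multiset (LTy × LTy)} {S : TSub} {b : ℕ} (h : UnifyQ P S b) :
    ∀ e ∈ P, e.1.applyS S = e.2.applyS S := by
  obtain ⟨P', hrun, -, hs⟩ := h
  exact hrun.unifies_of S hs.unifies

/-! ## Composition of type substitutions -/

/-- apply `S` first, then `T` -/
def TSub.comp (T S : TSub) : TSub := fun α => (S α).applyS T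

theorem LTy.applyS_comp (T S : TSub) (τ : LTy) :
    τ.applyS (TSub.comp T S) = (τ.applyS S).applyS T := by
  induction τ with
  | var α => rfl
  | lolly a b iha ihb => simp [LTy.applyS, iha, ihb]

theorem Ty2.applyS_comp (T S : TSub) (σ : Ty2) :
    σ.applyS (TSub.comp T S) = (σ.applyS S).applyS T := by
  induction σ with
  | lin τ => simp [Ty2.applyS, LTy.applyS_comp]
  | lolly τ σ ih => simp [Ty2.applyS, LTy.applyS_comp, ih]
  | arrow A σ ih => simp [Ty2.applyS, LTy.applyS_comp, ih]

theorem Ty2.applyS_mkLolly (S : TSub) (τ : LTy) (σ : Ty2) :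
    (Ty2.mkLolly τ σ).applyS S = Ty2.mkLolly (τ.applyS S) (σ.applyS S) := by
  cases σ <;> rfl

theorem LTy.applyS_id (τ : LTy) : τ.applyS .var = τ :=
  LTy.applyS_eq_self _ _ fun _ _ => rfl

theorem Ty2.applyS_id (σ : Ty2) : σ.applyS .var = σ := by
  induction σ with
  | lin τ => simp [Ty2.applyS, LTy.applyS_id]
  | lolly τ σ ih => simp [Ty2.applyS, LTy.applyS_id, ih]
  | arrow A σ ih => simp [Ty2.applyS, LTy.applyS_id, ih]

/-! ## The multi-type mirroring a linear rank 2 type -/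

/-- the rank 0 multi-type with the same shape as a linear type -/
def LTy.toMTy : LTy → MTy
  | .var α => .var α
  | .lolly a b => .lolly a.toMTy b.toMTy

/-- the rank 2 multi-type with the same shape as a linear rank 2 type -/
def Ty2.toMTy2 : Ty2 → MTy2
  | .lin τ => .base τ.toMTy
  | .lolly τ σ => .lolly τ.toMTy σ.toMTy2
  | .arrow A σ => .arrow (A.map LTy.toMTy) σ.toMTy2

theorem Ty2.toMTy2_mkLolly (τ : LTy) (σ : Ty2) :
    (Ty2.mkLolly τ σ).toMTy2 = MTy2.mkLolly τ.toMTy σ.toMTy2 := by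
  cases σ <;> rfl

/-- the pair consisting of a substituted sequence and the multi-type mirroring it -/
def mirror (S : TSub) : Multiset LTy →+ Multiset LTy × Multiset MTy :=
  (Multiset.mapAddMonoidHom (LTy.applyS S)).prod
    (Multiset.mapAddMonoidHom fun τ => (τ.applyS S).toMTy)

theorem mirror_apply (S : TSub) (A : Multiset LTy) :
    mirror S A = (A.map (LTy.applyS S), A.map fun τ => (τ.applyS S).toMTy) := rfl

/-! ## Environments -/

/-- rename the variables of an environment by `f` and map its predicates by `φ` -/
def mapEnv {β γ : Type} (f : ℕ → ℕ) (φ : β → γ) (Γ : List (ℕ × β)) : List (ℕ × γ) :=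
  Γ.map fun p => (f p.1, φ p.2)

section
variable {β γ : Type}

theorem map_fst_mapEnv (f : ℕ → ℕ) (φ : β → γ) (Γ : List (ℕ × β)) :
    (mapEnv f φ Γ).map Prod.fst = (Γ.map Prod.fst).map f := by
  simp [mapEnv]

theorem mapEnv_congr {f g : ℕ → ℕ} (φ : β → γ) {Γ : List (ℕ × β)}
    (h : ∀ x ∈ Γ.map Prod.fst, f x = g x) : mapEnv f φ Γ = mapEnv g φ Γ :=
  List.map_congr_left fun p hp => by rw [h p.1 (List.mem_map_of_mem hp)]

theorem mapEnv_envApplyS (T S : TSub) (f : ℕ → ℕ) (Γ : Env) :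
    mapEnv f (mirror T) (envApplyS S Γ) = mapEnv f (mirror (TSub.comp T S)) Γ := by
  simp [mapEnv, envApplyS, mirror_apply, LTy.applyS_comp]

theorem map_fst_envApplyS (S : TSub) (Γ : Env) :
    (envApplyS S Γ).map Prod.fst = Γ.map Prod.fst := by
  simp [envApplyS]

theorem map_fst_eraseG (Γ : List (ℕ × β)) (x : ℕ) :
    (eraseG Γ x).map Prod.fst = (Γ.map Prod.fst).filter fun y => !(y == x) := by
  simp [eraseG, List.filter_map, Function.comp_def]

theorem eraseG_of_notMem {Γ : List (ℕ × β)} {x : ℕ} (hx : x ∉ Γ.map Prod.fst) :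
    eraseG Γ x = Γ := by
  simp only [eraseG, List.filter_eq_self, Bool.not_eq_true', beq_eq_false_iff_ne]
  exact fun p hp h => hx (h ▸ List.mem_map_of_mem hp)

theorem perm_cons_eraseG {Γ : List (ℕ × β)} (hΓ : (Γ.map Prod.fst).Nodup) {x : ℕ} {A : β}
    (hx : (x, A) ∈ Γ) : Γ.Perm ((x, A) :: eraseG Γ x) := by
  induction Γ with
  | nil => simp at hx
  | cons p Γ ih =>
    simp only [List.map_cons, List.nodup_cons] at hΓ
    rcases List.mem_cons.1 hx with rfl | hx'
    · have : eraseG ((x, A) :: Γ) x = eraseG Γ x := by simp [eraseG]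
      rw [this, eraseG_of_notMem hΓ.1]
    · have hne : p.1 ≠ x := fun h => hΓ.1 (h ▸ List.mem_map_of_mem hx')
      have : eraseG (p :: Γ) x = p :: eraseG Γ x := by simp [eraseG, hne]
      rw [this]
      exact ((ih hΓ.2 hx').cons p).trans (List.Perm.swap _ _ _)

variable [Zero β] [Zero γ]

theorem lookupG_of_mem {Γ : List (ℕ × β)} (hΓ : (Γ.map Prod.fst).Nodup) {x : ℕ} {A : β}
    (hx : (x, A) ∈ Γ) : lookupG Γ x = A := by
  simp [lookupG, find?_fst_of_mem hΓ hx]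

theorem lookupG_of_notMem {Γ : List (ℕ × β)} {x : ℕ} (hx : x ∉ Γ.map Prod.fst) :
    lookupG Γ x = 0 := by
  simp [lookupG, find?_fst_of_notMem hx]

theorem lookupG_cons (p : ℕ × β) (Γ : List (ℕ × β)) (x : ℕ) :
    lookupG (p :: Γ) x = if p.1 = x then p.2 else lookupG Γ x := by
  by_cases h : p.1 = x <;> simp [lookupG, h]

theorem lookupG_eraseG (Γ : List (ℕ × β)) {x y : ℕ} (h : y ≠ x) :
    lookupG (eraseG Γ x) y = lookupG Γ y := by
  induction Γ with
  | nil => rfl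
  | cons p Γ ih =>
    by_cases hp : p.1 = x
    · have : eraseG (p :: Γ) x = eraseG Γ x := by simp [eraseG, hp]
      rw [this, ih, lookupG_cons, if_neg (by rw [hp]; exact h.symm)]
    · have : eraseG (p :: Γ) x = p :: eraseG Γ x := by simp [eraseG, hp]
      rw [this, lookupG_cons, lookupG_cons, ih]

theorem lookupG_mapEnv {f : ℕ → ℕ} {φ : β → γ} (hφ : φ 0 = 0) {Γ : List (ℕ × β)} {x : ℕ}
    (h : ∀ y ∈ Γ.map Prod.fst, f y = f x → y = x) :
    lookupG (mapEnv f φ Γ) (f x) = φ (lookupG Γ x) := by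
  induction Γ with
  | nil => simp [lookupG, mapEnv, hφ]
  | cons p Γ ih =>
    have hc : mapEnv f φ (p :: Γ) = (f p.1, φ p.2) :: mapEnv f φ Γ := rfl
    simp only [List.map_cons, List.forall_mem_cons] at h
    rw [hc, lookupG_cons, lookupG_cons, ih h.2]
    by_cases hp : p.1 = x
    · simp [hp]
    · rw [if_neg hp, if_neg fun h' => hp (h.1 h')]

theorem addG_nil [Add β] (Γ : List (ℕ × β)) : addG [] Γ = Γ := by
  simp [addG]

theorem addG_cons [Add β] {x : ℕ} (A : β) {Γ₁ : List (ℕ × β)} (Γ₂ : List (ℕ × β))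
    (hx : x ∉ Γ₁.map Prod.fst) :
    addG ((x, A) :: Γ₁) Γ₂ = (x, A + lookupG Γ₂ x) :: addG Γ₁ (eraseG Γ₂ x) := by
  simp only [addG, List.map_cons, List.cons_append, List.cons.injEq, true_and]
  congr 1
  · refine List.map_congr_left fun p hp => ?_
    rw [lookupG_eraseG]
    rintro rfl
    exact hx (List.mem_map_of_mem hp)
  · rw [eraseG, List.filter_filter]
    refine List.filter_congr fun p _ => ?_
    by_cases h : p.1 = x <;> simp [h, Bool.and_comm]

theorem map_fst_addG [Add β] (Γ₁ Γ₂ : List (ℕ × β)) :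
    (addG Γ₁ Γ₂).map Prod.fst = Γ₁.map Prod.fst ++
      (Γ₂.map Prod.fst).filter fun x => !((Γ₁.map Prod.fst).contains x) := by
  simp [addG, List.filter_map, Function.comp_def]

theorem mem_map_fst_addG [Add β] (Γ₁ Γ₂ : List (ℕ × β)) (x : ℕ) :
    x ∈ (addG Γ₁ Γ₂).map Prod.fst ↔ x ∈ Γ₁.map Prod.fst ∨ x ∈ Γ₂.map Prod.fst := by
  rw [map_fst_addG]
  simp only [List.mem_append, List.mem_filter, List.contains_eq_mem, Bool.not_eq_true',
    decide_eq_false_iff_not]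
  tauto

theorem nodup_map_fst_addG [Add β] {Γ₁ Γ₂ : List (ℕ × β)} (h₁ : (Γ₁.map Prod.fst).Nodup)
    (h₂ : (Γ₂.map Prod.fst).Nodup) : ((addG Γ₁ Γ₂).map Prod.fst).Nodup := by
  rw [map_fst_addG]
  refine h₁.append (h₂.filter _) fun x hx hx' => ?_
  simp only [List.mem_filter, List.contains_eq_mem, Bool.not_eq_true',
    decide_eq_false_iff_not] at hx'
  exact hx'.2 hx

theorem mem_map_fst_sumG [Add β] (l : List (List (ℕ × β))) (x : ℕ) :
    x ∈ (sumG l).map Prod.fst ↔ ∃ Γ ∈ l, x ∈ Γ.map Prod.fst := by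
  induction l with
  | nil => simp [sumG]
  | cons Γ l ih =>
    have : sumG (Γ :: l) = addG Γ (sumG l) := rfl
    rw [this, mem_map_fst_addG, ih]
    simp only [List.mem_cons, exists_eq_or_imp]

theorem nodup_map_fst_sumG [Add β] {l : List (List (ℕ × β))}
    (h : ∀ Γ ∈ l, (Γ.map Prod.fst).Nodup) : ((sumG l).map Prod.fst).Nodup := by
  induction l with
  | nil => simp [sumG]
  | cons Γ l ih =>
    simp only [List.forall_mem_cons] at h
    exact nodup_map_fst_addG h.1 (ih h.2)

end

theorem mapEnv_addG {β γ : Type} [AddZeroClass β] [AddZeroClass γ] {f : ℕ → ℕ} (φ : β →+ γ)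
    {s : Set ℕ} (hf : Set.InjOn f s) {Γ₁ Γ₂ : List (ℕ × β)} (h₁ : ∀ x ∈ Γ₁.map Prod.fst, x ∈ s)
    (h₂ : ∀ x ∈ Γ₂.map Prod.fst, x ∈ s) :
    mapEnv f φ (addG Γ₁ Γ₂) = addG (mapEnv f φ Γ₁) (mapEnv f φ Γ₂) := by
  have key : ∀ x ∈ s, (x ∈ Γ₁.map Prod.fst ↔ f x ∈ (Γ₁.map Prod.fst).map f) := fun x hx =>
    ⟨fun h => List.mem_map_of_mem h, fun h => by
      obtain ⟨y, hy, hxy⟩ := List.mem_map.1 h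
      exact hf (h₁ y hy) hx hxy ▸ hy⟩
  simp only [addG]
  rw [map_fst_mapEnv]
  simp only [mapEnv, List.map_append, List.map_map, List.filter_map]
  congr 1
  · refine List.map_congr_left fun p hp => ?_
    have hp' := h₁ _ (List.mem_map_of_mem hp)
    have := lookupG_mapEnv (φ := φ) (map_zero φ) (Γ := Γ₂) (f := f) (x := p.1)
      fun y hy hyx => hf (h₂ y hy) hp' hyx
    simp only [mapEnv] at this
    simp [this]
  · congr 1
    refine List.filter_congr fun p hp => ?_
    have := key p.1 (h₂ _ (List.mem_map_of_mem hp))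
    simp only [List.contains_eq_mem, Function.comp_apply, this, List.map_map, Function.comp_def]

theorem mapEnv_sumG {β γ : Type} [AddZeroClass β] [AddZeroClass γ] {f : ℕ → ℕ} (φ : β →+ γ)
    {s : Set ℕ} (hf : Set.InjOn f s) {l : List (List (ℕ × β))}
    (h : ∀ Γ ∈ l, ∀ x ∈ Γ.map Prod.fst, x ∈ s) :
    mapEnv f φ (sumG l) = sumG (l.map (mapEnv f φ)) := by
  induction l with
  | nil => rfl
  | cons Γ l ih =>
    have hl := (List.forall_mem_cons.1 h).2
    have : sumG (Γ :: l) = addG Γ (sumG l) := rfl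
    rw [this, mapEnv_addG φ hf (List.forall_mem_cons.1 h).1, ih hl]
    · rfl
    · intro x hx
      obtain ⟨Δ, hΔ, hx⟩ := (mem_map_fst_sumG l x).1 hx
      exact hl Δ hΔ x hx

/-! ## Renaming of free variables -/

namespace Term

/-- rename the free variables of a term by `f`, without avoiding capture -/
def ren : (ℕ → ℕ) → Term → Term
  | f, .var x => .var (f x)
  | f, .lam x M => .lam x (ren (Function.update f x x) M)
  | f, .app M N => .app (ren f M) (ren f N)

theorem ren_congr {M : Term} {f g : ℕ → ℕ} (h : ∀ x ∈ M.fv, f x = g x) : ren f M = ren g M := by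
  induction M generalizing f g with
  | var x => simp [ren, h x (by simp [fv])]
  | lam x M ih =>
    simp only [ren, lam.injEq, true_and]
    refine ih fun y hy => ?_
    by_cases hyx : y = x
    · simp [hyx]
    · simp [hyx, h y (by simp [fv, hy, hyx])]
  | app M N ihM ihN =>
    simp only [fv, Finset.mem_union] at h
    simp [ren, ihM fun x hx => h x (.inl hx), ihN fun x hx => h x (.inr hx)]

theorem ren_id (M : Term) : ren id M = M := by
  induction M with
  | var x => rfl
  | lam x M ih =>
    have : Function.update (id : ℕ → ℕ) x x = id := Function.update_eq_self x id
    simp [ren, this, ih]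
  | app M N ihM ihN => simp [ren, ihM, ihN]

theorem subst_self (M : Term) (x : ℕ) : M.subst x (.var x) = M := by
  induction M with
  | var y => by_cases h : y = x <;> simp [subst, h]
  | lam y M ih => by_cases h : y = x <;> simp [subst, h, ih]
  | app M N ihM ihN => simp [subst, ihM, ihN]

theorem subst_ren {M : Term} {k : ℕ} (hk : k ∉ M.allVars) (f : ℕ → ℕ) (w : ℕ) :
    (ren f M).subst k (.var w) = ren (fun y => if f y = k then w else f y) M := by
  induction M generalizing f with
  | var x => by_cases h : f x = k <;> simp [ren, subst, h]
  | lam x M ih =>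
    simp only [allVars, Finset.mem_insert, not_or] at hk
    have hx : x ≠ k := fun h => hk.1 h.symm
    simp only [ren, subst, hx, if_false, lam.injEq, true_and]
    rw [ih hk.2]
    congr 1
    funext y
    by_cases hy : y = x
    · subst hy; simp [hx]
    · simp [hy]
  | app M N ihM ihN =>
    simp only [allVars, Finset.mem_union, not_or] at hk
    simp [ren, subst, ihM hk.1, ihN hk.2]

/-- `f` renames the free variables of `M` injectively and without capture, each of
them being kept or renamed to a variable not occurring in `M` -/
def Renames (f : ℕ → ℕ) (M : Term) : Prop :=
  Set.InjOn f M.fv ∧ ∀ x ∈ M.fv, f x = x ∨ f x ∉ M.allVars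

theorem Renames.id (M : Term) : Renames id M :=
  ⟨Set.injOn_id _, fun _ _ => .inl rfl⟩

theorem Renames.right {f : ℕ → ℕ} {M N : Term} (h : Renames f (.app M N)) : Renames f N := by
  refine ⟨h.1.mono fun x hx => ?_, fun x hx => ?_⟩
  · simp only [Finset.mem_coe] at hx
    simp [fv, hx]
  · refine (h.2 x (by simp [fv, hx])).imp_right fun hx => ?_
    simp only [allVars, Finset.mem_union, not_or] at hx
    exact hx.2

theorem Renames.lam {f : ℕ → ℕ} {x : ℕ} {M : Term} (h : Renames f (.lam x M)) :
    Renames (Function.update f x x) M := by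
  have hfv : ∀ y ∈ M.fv, y ≠ x → y ∈ (Term.lam x M).fv := fun y hy hyx => by simp [fv, hy, hyx]
  have hne : ∀ y ∈ M.fv, y ≠ x → f y ≠ x := by
    intro y hy hyx hfy
    rcases h.2 y (hfv y hy hyx) with h' | h'
    · exact hyx (h' ▸ hfy)
    · exact h' (by simp [allVars, hfy])
  refine ⟨fun y hy z hz hyz => ?_, fun y hy => ?_⟩
  · by_cases hyx : y = x <;> by_cases hzx : z = x
    · rw [hyx, hzx]
    · subst hyx
      simp only [Function.update_self, Function.update_of_ne hzx] at hyz
      exact absurd hyz.symm (hne z hz hzx)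
    · subst hzx
      simp only [Function.update_self, Function.update_of_ne hyx] at hyz
      exact absurd hyz (hne y hy hyx)
    · simp only [Function.update_of_ne hyx, Function.update_of_ne hzx] at hyz
      exact h.1 (hfv y hy hyx) (hfv z hz hzx) hyz
  · by_cases hyx : y = x
    · simp [hyx]
    · rw [Function.update_of_ne hyx]
      refine (h.2 y (hfv y hy hyx)).imp_right fun h' h'' => h' ?_
      simp [allVars, h'']

end Term

/-! ## Structural rules of the quantitative system -/

theorem QDer.perm_append {Γ Γ' : QEnv} (h : Γ.Perm Γ') {b : ℕ} {M : Term} {σ : Ty2} {s : MTy2}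
    (E : QEnv) (hd : QDer (E ++ Γ) b M σ s) : QDer (E ++ Γ') b M σ s := by
  induction h generalizing E with
  | nil => exact hd
  | cons p _ ih => simpa using ih (E ++ [p]) (by simpa using hd)
  | swap p q l => exact QDer.exch E l q.1 p.1 q.2 p.2 b M σ s hd
  | trans _ _ ih₁ ih₂ => exact ih₂ E (ih₁ E hd)

theorem QDer.perm {Γ Γ' : QEnv} (h : Γ.Perm Γ') {b : ℕ} {M : Term} {σ : Ty2} {s : MTy2}
    (hd : QDer Γ b M σ s) : QDer Γ' b M σ s :=
  QDer.perm_append h [] hd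

/-- Contracting, one after the other, the variables of `R` whose names under `f` clash
with those of `Γ₂`, and which `g` shifts by `K`. -/
theorem QDer.contract {f : ℕ → ℕ} {K b : ℕ} {M₁ N₂ : Term} {σ : Ty2} {s : MTy2}
    (hM : ∀ x ∈ M₁.allVars, x < K) (hfM : ∀ x ∈ M₁.fv, f x < K)
    (hN : ∀ k, K ≤ k → ∀ w, N₂.subst k (.var w) = N₂)
    (R E Γ₂ : QEnv) (g : ℕ → ℕ)
    (hR : (E.map Prod.fst ++ (R.map Prod.fst).map f).Nodup)
    (hΓ₂ : ((E ++ Γ₂).map Prod.fst).Nodup)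
    (hRM : ∀ x ∈ R.map Prod.fst, x ∈ M₁.fv)
    (hg : ∀ x ∈ R.map Prod.fst, g x = if f x ∈ Γ₂.map Prod.fst then K + x else f x)
    (hgf : ∀ x ∈ M₁.fv, x ∉ R.map Prod.fst → g x = f x)
    (hd : QDer (E ++ (mapEnv g id R ++ Γ₂)) b (.app (M₁.ren g) N₂) σ s) :
    QDer (E ++ addG (mapEnv f id R) Γ₂) b (.app (M₁.ren f) N₂) σ s := by
  induction R generalizing E Γ₂ g with
  | nil =>
    have h : M₁.ren g = M₁.ren f := Term.ren_congr fun x hx => hgf x hx (by simp)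
    rw [h] at hd
    simpa [mapEnv, addG_nil] using hd
  | cons p R ih =>
    obtain ⟨z, A⟩ := p
    have hcons : ∀ h : ℕ → ℕ, mapEnv h id ((z, A) :: R) = (h z, A) :: mapEnv h id R :=
      fun _ => rfl
    simp only [List.map_cons, List.forall_mem_cons] at hRM hg
    have hR' : ((E.map Prod.fst ++ [f z]) ++ (R.map Prod.fst).map f).Nodup := by simpa using hR
    have hfz : f z ∉ (R.map Prod.fst).map f := by
      rw [List.nodup_append] at hR'
      exact fun h => hR'.2.2 (f z) (by simp) _ h rfl
    have hfzE : f z ∉ E.map Prod.fst := by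
      have := (List.nodup_append.1 (List.nodup_append.1 hR').1).2.2
      exact fun h => this _ h (f z) (by simp) rfl
    have hne : ∀ y ∈ R.map Prod.fst, f y ≠ f z :=
      fun y hy h => hfz (h ▸ List.mem_map_of_mem hy)
    have hzR : z ∉ R.map Prod.fst := fun h => hne z h rfl
    have hfzR : f z ∉ (mapEnv f id R).map Prod.fst := by rwa [map_fst_mapEnv]
    rw [hcons] at hd
    rw [hcons, addG_cons _ _ hfzR]
    by_cases hmem : f z ∈ Γ₂.map Prod.fst
    · rw [if_pos hmem] at hg
      obtain ⟨⟨w, B⟩, hB, hw⟩ := List.mem_map.1 hmem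
      simp only at hw
      subst hw
      have hndΓ₂ : (Γ₂.map Prod.fst).Nodup := by
        rw [List.map_append] at hΓ₂
        exact (List.nodup_append.1 hΓ₂).2.1
      have hperm := perm_cons_eraseG hndΓ₂ hB
      have hmemE : ∀ y ∈ R.map Prod.fst,
          (f y ∈ (eraseG Γ₂ (f z)).map Prod.fst ↔ f y ∈ Γ₂.map Prod.fst) := by
        intro y hy
        rw [map_fst_eraseG]
        simp [hne y hy]
      have hgy : ∀ y ∈ R.map Prod.fst, g y ≠ K + z ∧ g y ≠ f z := by
        intro y hy
        have h₁ := hfM y (hRM.2 y hy)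
        have h₂ := hfM z hRM.1
        have h₃ : y ≠ z := fun h => hzR (h ▸ hy)
        have h₄ := hne y hy
        rw [hg.2 y hy]
        split_ifs <;> omega
      have hd' : QDer (E ++ (K + z, A) :: (f z, B) :: (mapEnv g id R ++ eraseG Γ₂ (f z))) b
          (.app (M₁.ren g) N₂) σ s := by
        rw [hg.1] at hd
        refine QDer.perm_append ?_ E hd
        exact ((hperm.append_left (mapEnv g id R)).trans List.perm_middle).cons _
      have hc := QDer.contr E _ (K + z) (f z) (f z) A B b _ σ s hd' (by
        simp only [domG, List.map_append, List.mem_append, not_or, map_fst_mapEnv]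
        refine ⟨hfzE, fun h => ?_, ?_⟩
        · obtain ⟨y, hy, h⟩ := List.mem_map.1 h
          exact (hgy y hy).2 h
        · rw [map_fst_eraseG]; simp)
      rw [Term.subst_self] at hc
      simp only [Term.subst] at hc
      rw [hN _ (Nat.le_add_right _ _),
        Term.subst_ren fun h => absurd (hM _ h) (by omega)] at hc
      rw [lookupG_of_mem hndΓ₂ hB]
      have key := ih (E ++ [(f z, A + B)]) (eraseG Γ₂ (f z))
        (fun y => if g y = K + z then f z else g y) (by simpa using hR) ?_ hRM.2 ?_ ?_ ?_
      · simpa using key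
      · have h₁ : ((E ++ (f z, B) :: eraseG Γ₂ (f z)).map Prod.fst).Nodup :=
          ((hperm.append_left E).map Prod.fst).nodup_iff.1 hΓ₂
        simpa using h₁
      · intro y hy
        simp only [(hgy y hy).1, if_false, hmemE y hy]
        exact hg.2 y hy
      · intro y hy hyR
        by_cases hyz : y = z
        · subst hyz; simp [hg.1]
        · have h₁ := hgf y hy (by simpa [hyz] using hyR)
          have h₂ := hfM y hy
          have h₃ : g y ≠ K + z := by omega
          rw [if_neg h₃, h₁]
      · have h₁ : mapEnv (fun y => if g y = K + z then f z else g y) id R = mapEnv g id R :=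
          mapEnv_congr _ fun y hy => by simp only [(hgy y hy).1, if_false]
        rw [h₁]
        simpa using hc
    · rw [if_neg hmem] at hg
      rw [lookupG_of_notMem hmem, add_zero, eraseG_of_notMem hmem]
      rw [hg.1] at hd
      have key := ih (E ++ [(f z, A)]) Γ₂ g (by simpa using hR) ?_ hRM.2 hg.2 ?_
        (by simpa using hd)
      · simpa using key
      · have h₁ : ((f z, A) :: (E ++ Γ₂)).Perm ((E ++ [(f z, A)]) ++ Γ₂) := by
          simpa using List.perm_middle.symm
        rw [← (h₁.map Prod.fst).nodup_iff, List.map_cons, List.nodup_cons]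
        exact ⟨by simp only [List.map_append, List.mem_append, not_or]; exact ⟨hfzE, hmem⟩, hΓ₂⟩
      · intro y hy hyR
        by_cases hyz : y = z
        · subst hyz; exact hg.1
        · exact hgf y hy (by simpa [hyz] using hyR)

/-- `Γ` declares exactly the free variables of `M`, each of them once -/
def Declares (Γ : Env) (M : Term) : Prop :=
  (Γ.map Prod.fst).Nodup ∧ ∀ x, x ∈ Γ.map Prod.fst ↔ x ∈ M.fv

theorem Declares.lam {Γ : Env} {M : Term} (h : Declares Γ M) (x : ℕ) :
    Declares (eraseG Γ x) (.lam x M) := by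
  refine ⟨?_, fun y => ?_⟩
  · rw [map_fst_eraseG]; exact h.1.filter _
  · rw [map_fst_eraseG, List.mem_filter, h.2]; simp [Term.fv]

theorem Declares.app {Γ₁ Γ₂ : Env} {M₁ M₂ : Term} (h₁ : Declares Γ₁ M₁) (h₂ : Declares Γ₂ M₂)
    (S : TSub) : Declares (envApplyS S (addG Γ₁ Γ₂)) (.app M₁ M₂) := by
  refine ⟨?_, fun y => ?_⟩
  · rw [map_fst_envApplyS]; exact nodup_map_fst_addG h₁.1 h₂.1
  · rw [map_fst_envApplyS, mem_map_fst_addG, h₁.2, h₂.2]; simp [Term.fv]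

theorem Declares.sumG {l : List Env} {M : Term} (hl : l ≠ []) (h : ∀ Γ ∈ l, Declares Γ M) :
    Declares (sumG l) M := by
  refine ⟨nodup_map_fst_sumG fun Γ hΓ => (h Γ hΓ).1, fun x => ?_⟩
  rw [mem_map_fst_sumG]
  obtain ⟨Γ, hΓ⟩ := List.exists_mem_of_ne_nil l hl
  exact ⟨fun ⟨Δ, hΔ, hx⟩ => ((h Δ hΔ).2 x).1 hx, fun hx => ⟨Γ, hΓ, ((h Γ hΓ).2 x).2 hx⟩⟩

theorem QInfer.declares {M : Term} {Γ : Env} {σ : Ty2} {b : ℕ} (h : QInfer M Γ σ b) :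
    Declares Γ M := by
  induction h with
  | var x α => exact ⟨by simp, fun y => by simp [Term.fv]⟩
  | lamLolly x τ _ _ ih => exact ih.lam x
  | lamArrow x A _ _ _ ih => exact ih.lam x
  | appVar α₁ τ₂ α₂ α₃ S bu _ _ _ _ _ _ _ ih₁ ih₂ => exact ih₁.app ih₂ S
  | appArrow l ts S bu _ _ _ hl _ _ _ ih₁ ih₂ =>
    refine ih₁.app (Declares.sumG ?_ ?_) S
    · intro h
      rw [List.map_eq_nil_iff] at h
      simp [h] at hl
    · intro Γ hΓ
      obtain ⟨p, hp, rfl⟩ := List.mem_map.1 hΓ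
      exact ih₂ p hp
  | appLolly τ σ₁ τ₂ S bu _ _ _ _ ih₁ ih₂ => exact ih₁.app ih₂ S

/-- An application typed after separating the variables of `M₁` from those of `M₂` can be
typed in the merged environment. -/
theorem QDer.merge {f : ℕ → ℕ} {M₁ M₂ : Term} {Γ₁ Γ₂ : Env} {T : TSub} {σ : Ty2} {s : MTy2}
    (h₁ : Declares Γ₁ M₁) (h₂ : Declares Γ₂ M₂) (hf : Term.Renames f (.app M₁ M₂))
    (H : ∀ g, Term.Renames g M₁ →
      consistentG (mapEnv g (mirror T) Γ₁ ++ mapEnv f (mirror T) Γ₂) →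
      ∃ b, QDer (mapEnv g (mirror T) Γ₁ ++ mapEnv f (mirror T) Γ₂) b
        (.app (M₁.ren g) (M₂.ren f)) σ s) :
    ∃ b, QDer (mapEnv f (mirror T) (addG Γ₁ Γ₂)) b (Term.ren f (.app M₁ M₂)) σ s := by
  have hfv₁ : ∀ x ∈ M₁.fv, x ∈ (Term.app M₁ M₂).fv := fun x hx => by simp [Term.fv, hx]
  have hfv₂ : ∀ x ∈ M₂.fv, x ∈ (Term.app M₁ M₂).fv := fun x hx => by simp [Term.fv, hx]
  obtain ⟨K, hK⟩ := (M₁.allVars ∪ M₂.allVars ∪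
    (Term.app M₁ M₂).fv.image f).exists_nat_subset_range
  have hK₁ : ∀ x ∈ M₁.allVars, x < K := fun x hx => by
    simpa using hK (by simp [hx])
  have hK₂ : ∀ x ∈ M₂.allVars, x < K := fun x hx => by
    simpa using hK (by simp [hx])
  have hKf : ∀ x ∈ (Term.app M₁ M₂).fv, f x < K := fun x hx =>
    Finset.mem_range.1 (hK (Finset.mem_union_right _ (Finset.mem_image_of_mem f hx)))
  let g : ℕ → ℕ := fun x => if x ∈ M₂.fv then K + x else f x
  have hg : Term.Renames g M₁ := by
    refine ⟨fun x hx y hy hxy => ?_, fun x hx => ?_⟩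
    · have hx' := hfv₁ x hx
      have hy' := hfv₁ y hy
      have := hKf x hx'
      have := hKf y hy'
      simp only [g] at hxy
      split_ifs at hxy
      · omega
      · omega
      · omega
      · exact hf.1 hx' hy' hxy
    · by_cases hx₂ : x ∈ M₂.fv
      · right
        simp only [g, hx₂, if_true]
        exact fun h => absurd (hK₁ _ h) (by omega)
      · simp only [g, hx₂, if_false]
        refine (hf.2 x (hfv₁ x hx)).imp_right fun h h' => h ?_
        simp [Term.allVars, h']
  have hnd₂ : ((mapEnv f (mirror T) Γ₂).map Prod.fst).Nodup := by
    rw [map_fst_mapEnv]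
    exact h₂.1.map_on fun x hx y hy hxy =>
      hf.1 (hfv₂ x ((h₂.2 x).1 hx)) (hfv₂ y ((h₂.2 y).1 hy)) hxy
  have hcons : consistentG (mapEnv g (mirror T) Γ₁ ++ mapEnv f (mirror T) Γ₂) := by
    rw [consistentG, List.map_append]
    refine List.Nodup.append ?_ hnd₂ ?_
    · rw [map_fst_mapEnv]
      exact h₁.1.map_on fun x hx y hy hxy => hg.1 ((h₁.2 x).1 hx) ((h₁.2 y).1 hy) hxy
    · rw [map_fst_mapEnv, map_fst_mapEnv]
      intro w hw hw'
      obtain ⟨x, hx, rfl⟩ := List.mem_map.1 hw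
      obtain ⟨y, hy, hxy⟩ := List.mem_map.1 hw'
      have hx' := hfv₁ x ((h₁.2 x).1 hx)
      have hy₂ := (h₂.2 y).1 hy
      have := hKf y (hfv₂ y hy₂)
      simp only [g] at hxy
      split_ifs at hxy with hx₂
      · omega
      · exact hx₂ (hf.1 (hfv₂ y hy₂) hx' hxy ▸ hy₂)
  obtain ⟨b, hb⟩ := H g hg hcons
  refine ⟨b, ?_⟩
  have hmap : ∀ h : ℕ → ℕ, mapEnv h id (mapEnv id (mirror T) Γ₁) = mapEnv h (mirror T) Γ₁ :=
    fun h => by simp [mapEnv]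
  have hkeys : (mapEnv id (mirror T) Γ₁).map Prod.fst = Γ₁.map Prod.fst := by
    rw [map_fst_mapEnv, List.map_id]
  rw [mapEnv_addG (mirror T) hf.1 (fun x hx => hfv₁ x ((h₁.2 x).1 hx))
    (fun x hx => hfv₂ x ((h₂.2 x).1 hx)), ← hmap f]
  refine QDer.contract hK₁ (fun x hx => hKf x (hfv₁ x hx)) ?_ (mapEnv id (mirror T) Γ₁) []
    (mapEnv f (mirror T) Γ₂) g ?_ (by simpa using hnd₂) ?_ ?_ ?_ ?_
  · intro k hk w
    rw [Term.subst_ren fun h => absurd (hK₂ _ h) (by omega)]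
    refine Term.ren_congr fun x hx => ?_
    have := hKf x (hfv₂ x hx)
    exact if_neg (by omega)
  · rw [hkeys]
    simp only [List.map_nil, List.nil_append]
    exact h₁.1.map_on fun x hx y hy hxy =>
      hf.1 (hfv₁ x ((h₁.2 x).1 hx)) (hfv₁ y ((h₁.2 y).1 hy)) hxy
  · rw [hkeys]; exact fun x hx => (h₁.2 x).1 hx
  · rw [hkeys, map_fst_mapEnv]
    intro x hx
    have : f x ∈ (Γ₂.map Prod.fst).map f ↔ x ∈ M₂.fv := by
      rw [← h₂.2]
      refine ⟨fun h => ?_, fun h => List.mem_map_of_mem h⟩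
      obtain ⟨y, hy, hxy⟩ := List.mem_map.1 h
      exact hf.1 (hfv₂ y ((h₂.2 y).1 hy)) (hfv₁ x ((h₁.2 x).1 hx)) hxy ▸ hy
    simp only [this, g]
  · rw [hkeys]; exact fun x hx hx' => absurd ((h₁.2 x).2 hx) hx'
  · rw [hmap]; exact hb

/-- the environment of an abstraction body, with the bound variable moved last -/
theorem mapEnv_update_perm {Γ : Env} (hΓ : (Γ.map Prod.fst).Nodup) {x : ℕ} {A : Multiset LTy}
    (hx : (x, A) ∈ Γ) (f : ℕ → ℕ) (T : TSub) :
    (mapEnv (Function.update f x x) (mirror T) Γ).Perm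
      (mapEnv f (mirror T) (eraseG Γ x) ++ [(x, mirror T A)]) := by
  have h₁ : mapEnv (Function.update f x x) (mirror T) (eraseG Γ x) =
      mapEnv f (mirror T) (eraseG Γ x) := by
    refine mapEnv_congr _ fun y hy => ?_
    rw [map_fst_eraseG] at hy
    simp only [List.mem_filter, Bool.not_eq_true', beq_eq_false_iff_ne] at hy
    exact Function.update_of_ne hy.2 _ _
  have h₂ := (perm_cons_eraseG hΓ hx).map
    fun p => (Function.update f x x p.1, mirror T p.2)
  refine h₂.trans ?_
  rw [← h₁, List.map_cons, Function.update_self]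
  exact (List.perm_append_singleton _ _).symm

theorem map_eq_map_of_zip {α β γ : Type} {u : α → γ} {v : β → γ} {l₁ : List α} {l₂ : List β}
    (hl : l₁.length = l₂.length) (h : ∀ e ∈ l₁.zip l₂, u e.1 = v e.2) :
    l₁.map u = l₂.map v := by
  induction l₁ generalizing l₂ with
  | nil => cases l₂ with
    | nil => rfl
    | cons => simp at hl
  | cons a l₁ ih => cases l₂ with
    | nil => simp at hl
    | cons c l₂ =>
      simp only [List.zip_cons_cons, List.forall_mem_cons] at h
      simp [h.1, ih (by simpa using hl) h.2]

theorem QInfer.qDer {M : Term} {Γ : Env} {σ : Ty2} {b : ℕ} (h : QInfer M Γ σ b) (T : TSub)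
    (f : ℕ → ℕ) (hf : Term.Renames f M) :
    ∃ b', QDer (mapEnv f (mirror T) Γ) b' (M.ren f) (σ.applyS T) (σ.applyS T).toMTy2 := by
  induction h generalizing T f with
  | var x α => exact ⟨0, QDer.ax (f x) (T α) (T α).toMTy⟩
  | lamLolly x τ h₁ hx ih =>
    obtain ⟨b', hb⟩ := ih T _ hf.lam
    refine ⟨b' + 1, ?_⟩
    rw [Ty2.applyS_mkLolly, Ty2.toMTy2_mkLolly]
    exact QDer.introLolly _ x _ _ b' _ _ _
      (QDer.perm (mapEnv_update_perm h₁.declares.1 hx f T) hb)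
  | lamArrow x A h₁ hx hA ih =>
    obtain ⟨b', hb⟩ := ih T _ hf.lam
    refine ⟨b' + 1, ?_⟩
    have := QDer.introArrow _ x _ _ b' _ _ _
      (QDer.perm (mapEnv_update_perm h₁.declares.1 hx f T) hb) (by simpa using hA) (by simp)
    simpa [Ty2.applyS, Ty2.toMTy2, Term.ren] using this
  | appVar α₁ τ₂ α₂ α₃ S bu h₁ h₂ _ _ _ _ hU ih₁ ih₂ =>
    rw [mapEnv_envApplyS]
    refine QDer.merge h₁.declares h₂.declares hf fun g hg hc => ?_
    obtain ⟨b₁', hb₁⟩ := ih₁ (TSub.comp T S) g hg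
    obtain ⟨b₂', hb₂⟩ := ih₂ (TSub.comp T S) f hf.right
    have hu := hU.unifies
    simp only [Multiset.insert_eq_cons, Multiset.mem_cons, Multiset.mem_singleton,
      forall_eq_or_imp, forall_eq] at hu
    rw [Ty2.applyS_comp, Ty2.applyS, hu.1] at hb₁
    rw [Ty2.applyS_comp, Ty2.applyS, hu.2] at hb₂
    exact ⟨_, QDer.elimLolly _ _ b₁' b₂' _ _ _ (.lin _) _ (.base _) hb₁ hb₂ hc⟩
  | @appArrow M₁ M₂ Γ₁ σ₁ b₁ l ts S bu h₁ h₂ hlen hl _ _ hU ih₁ ih₂ =>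
    rw [mapEnv_envApplyS]
    have hdecl : ∀ Γ ∈ l.map Prod.fst, Declares Γ M₂ := fun Γ hΓ => by
      obtain ⟨p, hp, rfl⟩ := List.mem_map.1 hΓ
      exact (h₂ p hp).declares
    have hne : l.map Prod.fst ≠ [] := by
      intro h
      rw [List.map_eq_nil_iff] at h
      simp [h] at hl
    refine QDer.merge h₁.declares (Declares.sumG hne hdecl) hf fun g hg hc => ?_
    obtain ⟨b₁', hb₁⟩ := ih₁ (TSub.comp T S) g hg
    have hex := fun p hp => ih₂ p hp (TSub.comp T S) f hf.right
    choose! c hcd using hex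
    have hts : (l.map fun p => p.2.1).map (LTy.applyS S) = ts.map (LTy.applyS S) :=
      map_eq_map_of_zip (by simpa using hlen) fun e he => hU.unifies e he
    have hts' : ts.map (LTy.applyS (TSub.comp T S)) =
        l.map fun p => p.2.1.applyS (TSub.comp T S) := by
      have := congrArg (List.map (LTy.applyS T)) hts
      simpa [Function.comp_def, funext (LTy.applyS_comp T S)] using this.symm
    have hts'' : ts.map (fun τ => (τ.applyS (TSub.comp T S)).toMTy) =
        l.map fun p => (p.2.1.applyS (TSub.comp T S)).toMTy := by
      have := congrArg (List.map LTy.toMTy) hts'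
      simpa [Function.comp_def] using this
    let l' : List (QEnv × ℕ × LTy × MTy) := l.map fun p =>
      (mapEnv f (mirror (TSub.comp T S)) p.1, c p, p.2.1.applyS (TSub.comp T S),
        (p.2.1.applyS (TSub.comp T S)).toMTy)
    have hsum : mapEnv f (mirror (TSub.comp T S)) (sumG (l.map Prod.fst)) =
        sumG (l'.map Prod.fst) := by
      rw [mapEnv_sumG _ hf.right.1 fun Γ hΓ x hx => ((hdecl Γ hΓ).2 x).1 hx]
      simp [l', Function.comp_def]
    rw [hsum] at hc ⊢
    refine ⟨_, QDer.elimArrow _ b₁' _ _ _ _ l' ?_ ?_ (by simpa [l'] using hl) hc⟩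
    · rw [← Ty2.applyS_comp]
      simp only [l', List.map_map, Function.comp_def]
      rw [← hts', ← hts'']
      simpa [Ty2.applyS, Ty2.toMTy2, Function.comp_def] using hb₁
    · intro p hp
      obtain ⟨q, hq, rfl⟩ := List.mem_map.1 hp
      exact hcd q hq
  | appLolly τ σ₁ τ₂ S bu h₁ h₂ _ hU ih₁ ih₂ =>
    rw [mapEnv_envApplyS]
    refine QDer.merge h₁.declares h₂.declares hf fun g hg hc => ?_
    obtain ⟨b₁', hb₁⟩ := ih₁ (TSub.comp T S) g hg
    obtain ⟨b₂', hb₂⟩ := ih₂ (TSub.comp T S) f hf.right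
    have hu := hU.unifies
    simp only [Multiset.mem_singleton, forall_eq] at hu
    rw [Ty2.applyS_mkLolly, Ty2.toMTy2_mkLolly, LTy.applyS_comp, ← hu,
      Ty2.applyS_comp] at hb₁
    rw [Ty2.applyS_comp] at hb₂
    exact ⟨_, QDer.elimLolly _ _ b₁' b₂' _ _ _ _ _ _ hb₁ hb₂ hc⟩

/-- **Typing soundness of the quantitative inference algorithm.** If
`T_Q(M) = ([x₁:τ⃗₁, …, xₙ:τ⃗ₙ], σ, b)`, then there are `b'`, rank 1 multi-types
`t⃗₁, …, t⃗ₙ` and a rank 2 multi-type `s` such that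
`[x₁:(τ⃗₁,t⃗₁), …, xₙ:(τ⃗ₙ,t⃗ₙ)] ⊢^{b'} M : σ | s` is derivable. -/
theorem qinfer_typing_sound (M : Term) (Γ : Env) (σ : Ty2) (b : ℕ)
    (h : QInfer M Γ σ b) :
    ∃ (Δ : QEnv) (b' : ℕ) (s : MTy2),
      Δ.map (fun p => (p.1, p.2.1)) = Γ ∧ QDer Δ b' M σ s := by
  obtain ⟨b', hb⟩ := h.qDer .var id (Term.Renames.id M)
  rw [Ty2.applyS_id, Term.ren_id] at hb
  refine ⟨_, b', _, ?_, hb⟩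
  simp [mapEnv, mirror_apply, LTy.applyS_id, Function.comp_def]
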